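/- arXiv:1606.09350 — 5 statements merged into one kernel-verified Lean document; each statement's English description precedes it below -/
import Mathlib

section
/- For every integer m ≥ 1, the m-th Bernoulli number satisfies B_m = ∑_{p=1}^{m} (1/(p+1)) · ∑_{q=1}^{p} (−1)^q · (p choose q) · q^m (an identity in the rational numbers). -/
open Finset

open Polynomial in
theorem descPochhammer_eval_neg_one {R : Type*} [CommRing R] (n : ℕ) :
    (descPochhammer R n).eval (-1) = (-1) ^ n * (n.factorial : R) := by
  induction n with
  | zero => simp
  | succ n ih =>
    rw [descPochhammer_succ_eval, ih, Nat.factorial_succ]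
    push_cast
    ring

open Polynomial in
theorem descPochhammer_succ_coeff_one {R : Type*} [CommRing R] (n : ℕ) :
    (descPochhammer R (n + 1)).coeff 1 = (-1) ^ n * (n.factorial : R) := by
  rw [descPochhammer_succ_left, coeff_X_mul, coeff_zero_eq_eval_zero, eval_comp,
    ← descPochhammer_eval_neg_one]
  simp

theorem natCast_pow_eq_sum_choose_mul_fwdDiff_iter {R : Type*} [CommRing R] (m k : ℕ) :
    (k : R) ^ m =
      ∑ p ∈ range (m + 1), (k.choose p : R) * (fwdDiff (1 : R))^[p] (fun x : R ↦ x ^ m) 0 := by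
  have h := shift_eq_sum_fwdDiff_iter (1 : R) (fun x : R ↦ x ^ m) k 0
  simp only [zero_add, nsmul_eq_mul, mul_one] at h
  rw [h]
  rcases le_total k m with hkm | hkm
  · refine sum_subset (range_subset_range.2 (by lia)) fun p _ hp ↦ ?_
    rw [Nat.choose_eq_zero_of_lt (by simpa using hp), Nat.cast_zero, zero_mul]
  · refine (sum_subset (range_subset_range.2 (by lia)) fun p _ hp ↦ ?_).symm
    rw [fwdDiff_iter_pow_eq_zero_of_lt (by simpa using hp), Pi.zero_apply, mul_zero]

theorem sum_range_pow_eq_sum_choose_succ_mul_fwdDiff_iter {R : Type*} [CommRing R] (m n : ℕ) :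
    ∑ k ∈ range n, (k : R) ^ m =
      ∑ p ∈ range (m + 1), (n.choose (p + 1) : R) * (fwdDiff (1 : R))^[p] (fun x : R ↦ x ^ m) 0 := by
  induction n with
  | zero => simp
  | succ n ih =>
    rw [sum_range_succ, ih, natCast_pow_eq_sum_choose_mul_fwdDiff_iter, ← sum_add_distrib]
    refine sum_congr rfl fun p _ ↦ ?_
    rw [Nat.choose_succ_succ]
    push_cast
    ring

open Polynomial in
theorem bernoulli_eq_sum_fwdDiff_iter (m : ℕ) :
    _root_.bernoulli m =
      ∑ p ∈ range (m + 1), (-1) ^ p / ((p : ℚ) + 1) * (fwdDiff (1 : ℚ))^[p] (fun x : ℚ ↦ x ^ m) 0 := by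
  have key : ∑ i ∈ range (m + 1),
        C (_root_.bernoulli i * ((m + 1).choose i) / ((m : ℚ) + 1)) * X ^ (m + 1 - i) =
      ∑ p ∈ range (m + 1), C ((fwdDiff (1 : ℚ))^[p] (fun x : ℚ ↦ x ^ m) 0 / ((p + 1).factorial : ℚ)) *
        descPochhammer ℚ (p + 1) := by
    refine eq_of_infinite_eval_eq _ _ ((Set.infinite_range_of_injective
      (Nat.cast_injective (R := ℚ))).mono ?_)
    rintro _ ⟨n, rfl⟩
    have h := (sum_range_pow n m).symm.trans
      (sum_range_pow_eq_sum_choose_succ_mul_fwdDiff_iter m n)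
    simp only [Set.mem_ofPred_eq, eval_finsetSum, eval_mul, eval_C, eval_pow, eval_X]
    convert h using 2 with i _ p _
    · ring
    · rw [Nat.cast_choose_eq_descPochhammer_div]
      ring
  have hcoeff := congrArg (coeff · 1) key
  simp only [finsetSum_coeff, coeff_C_mul, descPochhammer_succ_coeff_one, coeff_X_pow] at hcoeff
  rw [sum_eq_single_of_mem m (self_mem_range_succ m)
    fun i hi him ↦ by rw [if_neg (by have := mem_range.1 hi; lia), mul_zero]] at hcoeff
  have hm : (m : ℚ) + 1 ≠ 0 := by positivity
  rw [if_pos (by lia), Nat.choose_succ_self_right, Nat.cast_succ, mul_one,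
    mul_div_cancel_right₀ _ hm] at hcoeff
  rw [hcoeff]
  refine sum_congr rfl fun p _ ↦ ?_
  have hp : (p.factorial : ℚ) ≠ 0 := by positivity
  rw [Nat.factorial_succ]
  push_cast
  field_simp

/-- For every integer `m ≥ 1`, the `m`-th Bernoulli number (with the
convention `t/(e^t - 1) = ∑ B_m t^m / m!`, which is Mathlib's `bernoulli`) satisfies
`B_m = ∑_{p=1}^{m} (1/(p+1)) ∑_{q=1}^{p} (-1)^q (p choose q) q^m` in `ℚ`. -/
theorem bernoulli_eq_sum_stirling (m : ℕ) (hm : 1 ≤ m) :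
    bernoulli m =
      ∑ p ∈ Finset.Icc 1 m, (1 / ((p : ℚ) + 1)) *
        ∑ q ∈ Finset.Icc 1 p, (-1 : ℚ) ^ q * (p.choose q : ℚ) * (q : ℚ) ^ m := by
  have hm0 : m ≠ 0 := by lia
  have hIcc (n : ℕ) (f : ℕ → ℚ) (hf : f 0 = 0) :
      ∑ i ∈ range (n + 1), f i = ∑ i ∈ Icc 1 n, f i := by
    rw [range_eq_Ico, sum_eq_sum_Ico_succ_bot n.succ_pos, hf, zero_add]
    rfl
  rw [bernoulli_eq_sum_fwdDiff_iter, hIcc _ _ (by simp [hm0])]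
  refine sum_congr rfl fun p _ ↦ ?_
  rw [fwdDiff_iter_eq_sum_shift, ← hIcc _ _ (by simp [hm0]), mul_sum, mul_sum]
  refine sum_congr rfl fun q hq ↦ ?_
  obtain ⟨r, rfl⟩ := Nat.exists_eq_add_of_le (Nat.lt_succ_iff.1 (mem_range.1 hq))
  have hr : (-1 : ℚ) ^ r * (-1) ^ r = 1 := by rw [← mul_pow]; simp
  simp only [Nat.add_sub_cancel_left, zero_add, nsmul_eq_mul, mul_one, zsmul_eq_mul]
  push_cast
  rw [pow_add]
  linear_combination (-1 : ℚ) ^ q / ((q : ℚ) + r + 1) * ((q + r).choose q) * (q : ℚ) ^ m * hr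
end

section
/- For all integers i ≥ 1 and j ≥ 1, the rational number b_{(i,j,0)} equals −i/j!. -/
open Finset

/-- `b i j k` from the paper, defined for `i ≥ 1` (we set `b 0 _ _ = 0`):
`b 1 j 0 = -1/j!`, `b 1 j k = (-1)^(j+1-k) * B_(j+1-k) / (j+1-k)!` for `k ≥ 1`, and for `i ≥ 2`,
`b i j k = ∑_{m=0}^{min(j, i+j-k)} ((-1)^m B_m / m!) * b (i-1) (j+1-m) k - (if k = 0 then 1/j! else 0)`.
Here `bernoulli` is Mathlib's Bernoulli number, with EGF `t/(e^t - 1)` (so `bernoulli 1 = -1/2`). -/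
def b : ℕ → ℕ → ℕ → ℚ
  | 0, _, _ => 0
  | 1, j, k =>
      if k = 0 then -(1 / (Nat.factorial j : ℚ))
      else (-1) ^ (j + 1 - k) * bernoulli (j + 1 - k) / (Nat.factorial (j + 1 - k) : ℚ)
  | (i + 2), j, k =>
      (∑ m ∈ Finset.range (min j (i + 2 + j - k) + 1),
        ((-1) ^ m * bernoulli m / (Nat.factorial m : ℚ)) * b (i + 1) (j + 1 - m) k)
      - (if k = 0 then 1 / (Nat.factorial j : ℚ) else 0)

theorem sum_bernoulli'_div_factorial (j : ℕ) :
    ∑ m ∈ range (j + 1), bernoulli' m / (m.factorial : ℚ) * (1 / ((j + 1 - m).factorial : ℚ))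
      = 1 / (j.factorial : ℚ) := by
  have h := sum_bernoulli' (j + 1)
  have hj : ((j + 1).factorial : ℚ) ≠ 0 := by positivity
  calc _ = (∑ m ∈ range (j + 1), ((j + 1).choose m : ℚ) * bernoulli' m)
        / ((j + 1).factorial : ℚ) := by
        rw [sum_div]
        refine sum_congr rfl fun m hm => ?_
        rw [Nat.cast_choose ℚ (mem_range.mp hm).le]
        field_simp
    _ = _ := by
        rw [h, Nat.factorial_succ]
        push_cast
        field_simp

/-- For all integers `i ≥ 1` and `j ≥ 1`, `b i j 0 = -i/j!`. -/
theorem b_k_zero (i j : ℕ) (hi : 1 ≤ i) (hj : 1 ≤ j) :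
    b i j 0 = -((i : ℚ) / (Nat.factorial j : ℚ)) := by
  induction i, hi using Nat.le_induction generalizing j with
  | base => simp [b]
  | succ n hn ih =>
    obtain ⟨n, rfl⟩ := Nat.exists_eq_add_of_le' hn
    have hmin : min j (n + 2 + j - 0) = j := by omega
    have hsum : ∑ m ∈ range (j + 1),
        ((-1) ^ m * bernoulli m / (m.factorial : ℚ)) * b (n + 1) (j + 1 - m) 0
        = -((n + 1 : ℕ) : ℚ) * (1 / (j.factorial : ℚ)) := by
      rw [← sum_bernoulli'_div_factorial, mul_sum]
      refine sum_congr rfl fun m hm => ?_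
      have := mem_range.mp hm
      rw [ih _ (by omega), bernoulli'_eq_bernoulli]
      ring
    rw [b, hmin, hsum, if_pos rfl]
    push_cast
    ring
end

section
/- For all integers i ≥ 1 and j ≥ 1, the rational number b_{(i,j,1)} equals ((−1)^j/j!) · ∑_{p=1}^{j} c_{(j,p)}/(i+p), where c_{(j,p)} := ∑_{q=1}^{p} (−1)^q · (p choose q) · q^j. -/
open Finset

/-- `c m p := ∑_{q=1}^{p} (-1)^q (p choose q) q^m`. -/
def c (m p : ℕ) : ℚ :=
  ∑ q ∈ Finset.Icc 1 p, (-1 : ℚ) ^ q * (p.choose q : ℚ) * (q : ℚ) ^ m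

open PowerSeries in
/-- The power series of `1 - e^(-t)`. -/
noncomputable def oneSubExpNeg : PowerSeries ℚ := 1 - evalNegHom (exp ℚ)

/-- The truncation to `p ≤ N` of `∑_{p ≥ 1} (1 - e^(-t))^p / (i + p)`. -/
noncomputable def truncLerch (i N : ℕ) : PowerSeries ℚ :=
  ∑ p ∈ Finset.range N, (1 / ((i : ℚ) + (p + 1 : ℕ))) • oneSubExpNeg ^ (p + 1)

open PowerSeries in
theorem bernoulli'PowerSeries_mul_oneSubExpNeg :
    bernoulli'PowerSeries ℚ * oneSubExpNeg = X := by
  have h := bernoulli'PowerSeries_mul_exp_sub_one ℚ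
  have e := exp_mul_exp_neg_eq_one (A := ℚ)
  rw [oneSubExpNeg]
  linear_combination evalNegHom (exp ℚ) * h + (X - bernoulli'PowerSeries ℚ) * e

open PowerSeries in
theorem X_dvd_oneSubExpNeg : (X : PowerSeries ℚ) ∣ oneSubExpNeg := by
  rw [X_dvd_iff, ← coeff_zero_eq_constantCoeff_apply, oneSubExpNeg, evalNegHom, map_sub,
    coeff_rescale, coeff_exp]
  simp

open PowerSeries in
theorem coeff_oneSubExpNeg_pow_of_lt {j p : ℕ} (h : j < p) :
    coeff j (oneSubExpNeg ^ p) = 0 :=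
  X_pow_dvd_iff.1 (pow_dvd_pow_of_dvd X_dvd_oneSubExpNeg p) j h

open PowerSeries in
theorem derivative_oneSubExpNeg :
    d⁄dX ℚ oneSubExpNeg = 1 - oneSubExpNeg := by
  ext n
  simp only [oneSubExpNeg, evalNegHom, coeff_derivative, map_sub, coeff_rescale, coeff_exp,
    coeff_one]
  have : (n.factorial : ℚ) ≠ 0 := by positivity
  simp [Nat.factorial_succ]
  field_simp
  ring

open PowerSeries in
theorem coeff_oneSubExpNeg_pow {j : ℕ} (hj : 1 ≤ j) (p : ℕ) :
    coeff j (oneSubExpNeg ^ p) = (-1 : ℚ) ^ j / (j.factorial : ℚ) * c j p := by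
  have hpow (q : ℕ) : coeff j (evalNegHom (exp ℚ) ^ q) =
      (-1 : ℚ) ^ j / (j.factorial : ℚ) * (q : ℚ) ^ j := by
    rw [← map_pow, exp_pow_eq_rescale_exp]
    simp [evalNegHom, coeff_rescale, coeff_exp]
    ring
  have hexp : oneSubExpNeg ^ p = ∑ q ∈ Finset.range (p + 1),
      ((-1 : ℚ) ^ q * (p.choose q : ℚ)) • evalNegHom (exp ℚ) ^ q := by
    rw [oneSubExpNeg, sub_eq_neg_add, add_pow]
    refine Finset.sum_congr rfl fun q _ => ?_
    rw [smul_eq_C_mul, neg_pow]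
    simp
    ring
  rw [hexp, c, map_sum, Finset.range_eq_Ico, Finset.sum_eq_sum_Ico_succ_bot (by omega),
    Finset.mul_sum]
  simp only [map_smul, hpow, smul_eq_mul]
  rw [Nat.cast_zero, zero_pow (by omega), mul_zero, mul_zero, zero_add]
  refine Finset.sum_congr (by ext; simp) fun q _ => by ring

open PowerSeries in
theorem coeff_truncLerch {i j N : ℕ} (hj : 1 ≤ j) (hN : j ≤ N) :
    coeff j (truncLerch i N) = (-1 : ℚ) ^ j / (j.factorial : ℚ) *
      ∑ p ∈ Finset.Icc 1 j, c j p / ((i : ℚ) + (p : ℚ)) := by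
  have hsub : Finset.range j ⊆ Finset.range N := by simpa using hN
  rw [truncLerch, map_sum, ← Finset.sum_subset hsub, Finset.mul_sum,
    Finset.range_eq_Ico, Finset.sum_Ico_add'
      (fun p => coeff j ((1 / ((i : ℚ) + (p : ℕ))) • oneSubExpNeg ^ p)) 0 j 1]
  · refine Finset.sum_congr (by ext; simp) fun p _ => ?_
    rw [map_smul, coeff_oneSubExpNeg_pow hj, smul_eq_mul]
    ring
  · intro p _ hp
    rw [map_smul, coeff_oneSubExpNeg_pow_of_lt (by simp at hp; omega), smul_zero]

open PowerSeries in
theorem coeff_zero_truncLerch (i N : ℕ) : coeff 0 (truncLerch i N) = 0 := by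
  rw [truncLerch, map_sum]
  refine Finset.sum_eq_zero fun p _ => ?_
  rw [map_smul, coeff_oneSubExpNeg_pow_of_lt (by omega), smul_zero]

open PowerSeries in
theorem truncLerch_succ (i N : ℕ) :
    truncLerch i (N + 1) = oneSubExpNeg * (truncLerch (i + 1) N + C (1 / ((i : ℚ) + 1))) := by
  rw [truncLerch, truncLerch, Finset.sum_range_succ', mul_add, Finset.mul_sum]
  congr 1
  · refine Finset.sum_congr rfl fun p _ => ?_
    rw [mul_smul_comm, ← pow_succ']
    congr 2
    push_cast
    ring
  · rw [smul_eq_C_mul]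
    simp [mul_comm]

open PowerSeries in
theorem bernoulli'PowerSeries_mul_truncLerch (i N : ℕ) :
    bernoulli'PowerSeries ℚ * truncLerch i (N + 1) =
      X * (truncLerch (i + 1) N + C (1 / ((i : ℚ) + 1))) := by
  rw [truncLerch_succ, ← mul_assoc, bernoulli'PowerSeries_mul_oneSubExpNeg]

open PowerSeries in
theorem derivative_truncLerch_zero (N : ℕ) :
    d⁄dX ℚ (truncLerch 0 N) = 1 - oneSubExpNeg ^ N := by
  rw [truncLerch, map_sum, ← geom_sum_mul_neg, Finset.sum_mul]
  refine Finset.sum_congr rfl fun p _ => ?_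
  have hp : ((p : ℚ) + 1) ≠ 0 := by positivity
  rw [Derivation.map_smul, derivative_pow, derivative_oneSubExpNeg, smul_eq_C_mul]
  have hC : (C (1 / (((0 : ℕ) : ℚ) + (p + 1 : ℕ))) : PowerSeries ℚ) * ((p + 1 : ℕ) : PowerSeries ℚ)
      = 1 := by
    rw [← map_natCast (C : ℚ →+* PowerSeries ℚ), ← map_mul]
    push_cast
    rw [zero_add, one_div_mul_cancel hp, map_one]
  rw [Nat.add_sub_cancel]
  linear_combination oneSubExpNeg ^ p * (1 - oneSubExpNeg) * hC

open PowerSeries in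
theorem coeff_truncLerch_zero {j N : ℕ} (hN : j ≤ N) :
    coeff j (truncLerch 0 N) = if j = 1 then 1 else 0 := by
  obtain _ | j := j
  · simp [coeff_zero_truncLerch]
  have h := congrArg (coeff j) (derivative_truncLerch_zero N)
  rw [coeff_derivative, map_sub, coeff_oneSubExpNeg_pow_of_lt (by omega), coeff_one] at h
  have hj : ((j : ℚ) + 1) ≠ 0 := by positivity
  rw [eq_div_of_mul_eq hj h]
  by_cases h0 : j = 0 <;> simp [h0]

open PowerSeries in
theorem coeff_truncLerch_succ (i : ℕ) {j : ℕ} (hj : 1 ≤ j) :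
    coeff j (truncLerch (i + 1) j) = ∑ m ∈ Finset.range (j + 1),
      ((-1) ^ m * bernoulli m / (Nat.factorial m : ℚ)) *
        coeff (j + 1 - m) (truncLerch i (j + 1)) := by
  have h := congrArg (coeff (j + 1)) (bernoulli'PowerSeries_mul_truncLerch i j)
  rw [coeff_succ_X_mul, map_add, coeff_C, if_neg (by omega), add_zero, coeff_mul,
    Finset.Nat.sum_antidiagonal_eq_sum_range_succ
      (fun m n => coeff m (bernoulli'PowerSeries ℚ) * coeff n (truncLerch i (j + 1))),
    Finset.sum_range_succ, Nat.sub_self, coeff_zero_truncLerch, mul_zero, add_zero] at h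
  rw [← h]
  refine Finset.sum_congr rfl fun m _ => ?_
  simp [bernoulli'PowerSeries, bernoulli'_eq_bernoulli]

theorem b_one_eq_coeff_truncLerch (i : ℕ) {j : ℕ} (hj : 1 ≤ j) :
    b (i + 1) j 1 = PowerSeries.coeff j (truncLerch (i + 1) j) := by
  induction i generalizing j with
  | zero =>
    rw [coeff_truncLerch_succ 0 hj, Finset.sum_eq_single j]
    · rw [coeff_truncLerch_zero (by omega), if_pos (by omega)]
      simp [b]
    · intro m hm hne
      rw [coeff_truncLerch_zero (by omega), if_neg (by simp at hm; omega), mul_zero]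
    · simp
  | succ i ih =>
    rw [coeff_truncLerch_succ (i + 1) hj, b, if_neg one_ne_zero, sub_zero,
      min_eq_left (by omega)]
    refine Finset.sum_congr rfl fun m hm => ?_
    have hm' : 1 ≤ j + 1 - m := by simp at hm; omega
    rw [ih hm', coeff_truncLerch hm' le_rfl, coeff_truncLerch hm' (by omega)]

/-- For all integers `i ≥ 1` and `j ≥ 1`,
`b i j 1 = ((-1)^j / j!) * ∑_{p=1}^{j} c j p / (i + p)`. -/
theorem b_k_one (i j : ℕ) (hi : 1 ≤ i) (hj : 1 ≤ j) :
    b i j 1 = ((-1 : ℚ) ^ j / (Nat.factorial j : ℚ)) *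
      ∑ p ∈ Finset.Icc 1 j, c j p / ((i : ℚ) + (p : ℚ)) := by
  obtain ⟨i, rfl⟩ := Nat.exists_eq_add_of_le' hi
  rw [b_one_eq_coeff_truncLerch i hj, coeff_truncLerch hj le_rfl]
end

section
/- For every integer i ≥ 1, the rational number b_{(i,1,1)} equals 1/(i+1). -/
open Finset

section

open PowerSeries

/-- The power series `(1 - e^{-X}) / X`. -/
noncomputable def oneSubExpNegDivX : ℚ⟦X⟧ :=
  PowerSeries.mk fun n => coeff (n + 1) (1 - evalNegHom (exp ℚ))

theorem X_mul_oneSubExpNegDivX :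
    X * oneSubExpNegDivX = 1 - evalNegHom (exp ℚ) := by
  ext n
  cases n with
  | zero =>
    rw [coeff_zero_X_mul, map_sub, evalNegHom, coeff_rescale]
    simp
  | succ n => rw [coeff_succ_X_mul, oneSubExpNegDivX, coeff_mk]

theorem bernoulli'PowerSeries_mul_oneSubExpNegDivX :
    bernoulli'PowerSeries ℚ * oneSubExpNegDivX = 1 := by
  apply mul_left_cancel₀ (X_ne_zero (R := ℚ))
  linear_combination bernoulli'PowerSeries ℚ * X_mul_oneSubExpNegDivX
    + evalNegHom (exp ℚ) * bernoulli'PowerSeries_mul_exp_sub_one ℚ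
    + (X - bernoulli'PowerSeries ℚ) * exp_mul_exp_neg_eq_one (A := ℚ)

theorem constantCoeff_oneSubExpNegDivX : constantCoeff oneSubExpNegDivX = 1 := by
  have h := congrArg constantCoeff bernoulli'PowerSeries_mul_oneSubExpNegDivX
  simpa [bernoulli'PowerSeries] using h

theorem derivative_X_mul_oneSubExpNegDivX :
    d⁄dX ℚ (X * oneSubExpNegDivX) = 1 - X * oneSubExpNegDivX := by
  have h := congrArg (d⁄dX ℚ) (exp_mul_exp_neg_eq_one (A := ℚ))
  rw [Derivation.leibniz, derivative_exp, Derivation.map_one_eq_zero,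
    smul_eq_mul, smul_eq_mul] at h
  rw [X_mul_oneSubExpNegDivX, map_sub, Derivation.map_one_eq_zero]
  linear_combination -evalNegHom (exp ℚ) * h
    + (d⁄dX ℚ (evalNegHom (exp ℚ)) + evalNegHom (exp ℚ)) * exp_mul_exp_neg_eq_one (A := ℚ)

/-- The generating function `∑ b (i + 1) (n + 1) 1 X ^ n`. -/
noncomputable def bSeries (i : ℕ) : ℚ⟦X⟧ :=
  PowerSeries.mk fun n => b (i + 1) (n + 1) 1

theorem X_mul_bSeries_zero : X * bSeries 0 = bernoulli'PowerSeries ℚ - 1 := by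
  ext n
  cases n with
  | zero => simp [bernoulli'PowerSeries]
  | succ n =>
    rw [coeff_succ_X_mul, bSeries, coeff_mk, b]
    simp [bernoulli'PowerSeries, bernoulli'_eq_bernoulli, coeff_one]

theorem X_mul_bSeries_succ (i : ℕ) :
    X * bSeries (i + 1) = bernoulli'PowerSeries ℚ * bSeries i - C (b (i + 1) 1 1) := by
  ext n
  cases n with
  | zero => simp [bernoulli'PowerSeries, bSeries]
  | succ n =>
    rw [coeff_succ_X_mul, bSeries, coeff_mk, b, map_sub, coeff_mul,
      Finset.Nat.sum_antidiagonal_eq_sum_range_succ_mk,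
      show min (n + 1) (i + 2 + (n + 1) - 1) = n + 1 by omega]
    simp only [one_ne_zero, if_false, coeff_C, Nat.succ_ne_zero, sub_zero]
    refine Finset.sum_congr rfl fun m hm => ?_
    have hm' : m ≤ n + 1 := by simpa [Nat.lt_succ_iff] using hm
    simp [bernoulli'PowerSeries, bSeries, bernoulli'_eq_bernoulli,
      Nat.sub_add_comm hm']

theorem X_mul_bSeries_succ_mul (i : ℕ) :
    X * bSeries (i + 1) * oneSubExpNegDivX =
      bSeries i - C (b (i + 1) 1 1) * oneSubExpNegDivX := by
  rw [X_mul_bSeries_succ]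
  linear_combination bSeries i * bernoulli'PowerSeries_mul_oneSubExpNegDivX

theorem b_succ_one_one_of_derivative {i : ℕ}
    (h : d⁄dX ℚ (X * bSeries i * (X * oneSubExpNegDivX) ^ (i + 1)) =
      (X * oneSubExpNegDivX) ^ (i + 1)) :
    b (i + 1) 1 1 * (i + 2) = 1 := by
  have hc := congrArg (coeff (i + 1)) h
  rw [coeff_derivative, mul_pow,
    show X * bSeries i * (X ^ (i + 1) * oneSubExpNegDivX ^ (i + 1)) =
      X ^ (i + 1 + 1) * (bSeries i * oneSubExpNegDivX ^ (i + 1)) by ring,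
    coeff_X_pow_mul', coeff_X_pow_mul'] at hc
  simp [constantCoeff_oneSubExpNegDivX] at hc
  simp [bSeries] at hc
  linear_combination hc

theorem derivative_X_mul_bSeries_mul_pow (i : ℕ) :
    d⁄dX ℚ (X * bSeries i * (X * oneSubExpNegDivX) ^ (i + 1)) =
      (X * oneSubExpNegDivX) ^ (i + 1) := by
  induction i with
  | zero =>
    have h : X * bSeries 0 * (X * oneSubExpNegDivX) ^ (0 + 1) = X - X * oneSubExpNegDivX := by
      rw [X_mul_bSeries_zero]
      linear_combination X * bernoulli'PowerSeries_mul_oneSubExpNegDivX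
    rw [h, map_sub, derivative_X, derivative_X_mul_oneSubExpNegDivX]
    ring
  | succ i ih =>
    have hb := congrArg (C (R := ℚ)) (b_succ_one_one_of_derivative ih)
    have h : X * bSeries (i + 1) * (X * oneSubExpNegDivX) ^ (i + 1 + 1) =
        X * bSeries i * (X * oneSubExpNegDivX) ^ (i + 1) -
          C (b (i + 1) 1 1) * (X * oneSubExpNegDivX) ^ (i + 2) := by
      linear_combination X * (X * oneSubExpNegDivX) ^ (i + 1) * X_mul_bSeries_succ_mul i
    rw [h, map_sub, ih, Derivation.leibniz, derivative_C, derivative_pow,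
      derivative_X_mul_oneSubExpNegDivX]
    simp only [map_mul, map_add, map_natCast, map_ofNat, map_one] at hb
    simp only [smul_eq_mul, Nat.cast_add, Nat.cast_ofNat, show i + 2 - 1 = i + 1 from rfl]
    linear_combination -(X * oneSubExpNegDivX) ^ (i + 1) * (1 - X * oneSubExpNegDivX) * hb

end

/-- For every integer `i ≥ 1`, `b i 1 1 = 1/(i+1)`. -/
theorem b_one_one (i : ℕ) (hi : 1 ≤ i) :
    b i 1 1 = 1 / ((i : ℚ) + 1) := by
  obtain ⟨i, rfl⟩ := Nat.exists_eq_add_of_le' hi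
  have h := b_succ_one_one_of_derivative (derivative_X_mul_bSeries_mul_pow i)
  rw [eq_div_iff (by positivity)]
  push_cast
  linear_combination h
end

section
/- For all integers p ≥ 2 and j ≥ 1, one has ∑_{q=1}^{p} (−1)^q · (p choose q) · (∑_{r=1}^{q−1} r^j) = −∑_{r=1}^{p−1} (−1)^r · (p−1 choose r) · r^j, i.e. this double sum equals −c_{(j,p−1)}, where c_{(j,p−1)} := ∑_{r=1}^{p−1} (−1)^r · (p−1 choose r) · r^j. -/
open Finset

/-- Pascal's rule summed against a function: an alternating binomial sum of order `n + 1`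
is minus the alternating binomial sum of order `n` of the forward difference. -/
theorem sum_range_neg_one_pow_mul_choose_succ_mul {R : Type*} [CommRing R] (n : ℕ) (g : ℕ → R) :
    ∑ q ∈ Finset.range (n + 2), (-1) ^ q * ((n + 1).choose q : R) * g q
      = -∑ q ∈ Finset.range (n + 1), (-1) ^ q * (n.choose q : R) * (g (q + 1) - g q) := by
  have h : ∑ q ∈ Finset.range (n + 1), (-1) ^ q * (n.choose q : R) * g q
      = ∑ q ∈ Finset.range (n + 1), (-1) ^ (q + 1) * (n.choose (q + 1) : R) * g (q + 1) + g 0 := by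
    have := Finset.sum_range_succ' (fun q => (-1) ^ q * (n.choose q : R) * g q) (n + 1)
    simpa [Finset.sum_range_succ _ (n + 1)] using this
  simp only [mul_sub, Finset.sum_sub_distrib, h]
  rw [Finset.sum_range_succ', neg_sub, add_sub_right_comm, ← Finset.sum_sub_distrib]
  simp only [Nat.choose_succ_succ, Nat.cast_add, pow_zero, Nat.choose_zero_right, Nat.cast_one,
    one_mul]
  congr 1
  exact Finset.sum_congr rfl fun q _ => by ring

/-- A sum over `1, …, n - 1` is a sum over `0, …, n - 1` if the summand vanishes at `0`. -/
theorem sum_Icc_one_sub_one_eq_sum_range {M : Type*} [AddCommMonoid M] {f : ℕ → M} (hf : f 0 = 0)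
    (n : ℕ) : ∑ r ∈ Finset.Icc 1 (n - 1), f r = ∑ r ∈ Finset.range n, f r := by
  refine Finset.sum_subset (fun r hr => ?_) fun r hr hr' => ?_
  · simp only [Finset.mem_Icc, Finset.mem_range] at *
    omega
  · obtain rfl : r = 0 := by
      simp only [Finset.mem_Icc, Finset.mem_range] at *
      omega
    exact hf

/-- For all integers `p ≥ 2` and `j ≥ 1`,
`∑_{q=1}^{p} (-1)^q (p choose q) (∑_{r=1}^{q-1} r^j) = -∑_{r=1}^{p-1} (-1)^r ((p-1) choose r) r^j`,
i.e. the double sum equals `-c_{(j,p-1)}`. -/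
theorem sum_choose_powersum (p j : ℕ) (hp : 2 ≤ p) (hj : 1 ≤ j) :
    ∑ q ∈ Finset.Icc 1 p, (-1 : ℤ) ^ q * (p.choose q : ℤ) *
        (∑ r ∈ Finset.Icc 1 (q - 1), (r : ℤ) ^ j)
      = -∑ r ∈ Finset.Icc 1 (p - 1), (-1 : ℤ) ^ r * ((p - 1).choose r : ℤ) * (r : ℤ) ^ j := by
  obtain ⟨n, rfl⟩ : ∃ n, p = n + 1 := ⟨p - 1, by omega⟩
  have hj0 : j ≠ 0 := by omega
  have hpow (q : ℕ) : ∑ r ∈ Finset.Icc 1 (q - 1), (r : ℤ) ^ j = ∑ r ∈ Finset.range q, (r : ℤ) ^ j :=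
    sum_Icc_one_sub_one_eq_sum_range (by simp [hj0]) q
  simp only [hpow]
  rw [sum_Icc_one_sub_one_eq_sum_range (by simp [hj0])]
  refine (sum_Icc_one_sub_one_eq_sum_range (by simp) (n + 2)).trans ?_
  rw [sum_range_neg_one_pow_mul_choose_succ_mul]
  simp [Finset.sum_range_succ]
end
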